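/- Let Ω ⊆ ℝ² be a convex open set and let 𝔸 : Ω → ℝ^{2×2} be a smooth matrix field such that 𝔸(x) is symmetric for every x ∈ Ω and divdiv 𝔸 = 0 on Ω. Then there exists a smooth vector field θ : Ω → ℝ² with symcurl θ = 𝔸 on Ω. (Qualitative smooth version of the right-inverse of the symcurl operator; exactness of the two-dimensional div-div complex at its middle slot.) -/

import Mathlib

open MeasureTheory

noncomputable section

abbrev E2 : Type := EuclideanSpace ℝ (Fin 2)

/-- Partial derivative in direction `i`. -/
def pd (i : Fin 2) (f : E2 → ℝ) (x : E2) : ℝ :=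
  fderiv ℝ f x (EuclideanSpace.single i 1)

/-- Row-wise curl of a vector field: the `i`-th row is `(∂₂θᵢ, −∂₁θᵢ)`. -/
def curlVec (θ : E2 → Fin 2 → ℝ) (x : E2) : Matrix (Fin 2) (Fin 2) ℝ :=
  Matrix.of fun i j => if j = 0 then pd 1 (fun y => θ y i) x else -(pd 0 (fun y => θ y i) x)

/-- Symmetric part of the row-wise curl. -/
def symCurl (θ : E2 → Fin 2 → ℝ) (x : E2) : Matrix (Fin 2) (Fin 2) ℝ :=
  (2⁻¹ : ℝ) • (curlVec θ x + (curlVec θ x).transpose)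

/-- Row-wise divergence of a matrix field. -/
def divMat (B : E2 → Matrix (Fin 2) (Fin 2) ℝ) (x : E2) : Fin 2 → ℝ :=
  fun i => pd 0 (fun y => B y i 0) x + pd 1 (fun y => B y i 1) x

/-- Double divergence of a matrix field. -/
def divDiv (B : E2 → Matrix (Fin 2) (Fin 2) ℝ) (x : E2) : ℝ :=
  pd 0 (fun y => divMat B y 0) x + pd 1 (fun y => divMat B y 1) x

/-- Hessian of a scalar field. -/
def hess (v : E2 → ℝ) (x : E2) : Matrix (Fin 2) (Fin 2) ℝ :=
  Matrix.of fun i j => pd i (fun y => pd j v y) x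

/-- Jacobian matrix of a vector field. -/
def jac (θ : E2 → Fin 2 → ℝ) (x : E2) : Matrix (Fin 2) (Fin 2) ℝ :=
  Matrix.of fun i j => pd j (fun y => θ y i) x

/-- Frobenius inner product of 2×2 matrices. -/
def frob (A B : Matrix (Fin 2) (Fin 2) ℝ) : ℝ := ∑ i, ∑ j, A i j * B i j

theorem pd_contDiffOn {Ω : Set E2} (hopen : IsOpen Ω) {f : E2 → ℝ}
    (hf : ContDiffOn ℝ (⊤ : ℕ∞) f Ω) (i : Fin 2) : ContDiffOn ℝ (⊤ : ℕ∞) (pd i f) Ω := by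
  have h := ((contDiffOn_infty_iff_fderiv_of_isOpen hopen).1 hf).2
  exact h.clm_apply contDiffOn_const

theorem exists_potential {Ω : Set E2} (hconv : Convex ℝ Ω) (hopen : IsOpen Ω)
    {g₀ g₁ : E2 → ℝ} (h₀ : ContDiffOn ℝ (⊤ : ℕ∞) g₀ Ω) (h₁ : ContDiffOn ℝ (⊤ : ℕ∞) g₁ Ω)
    (hc : ∀ x ∈ Ω, pd 1 g₀ x = pd 0 g₁ x) :
    ∃ f : E2 → ℝ, ContDiffOn ℝ (⊤ : ℕ∞) f Ω ∧
      ∀ x ∈ Ω, pd 0 f x = g₀ x ∧ pd 1 f x = g₁ x := by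
  let p : Fin 2 → (E2 →L[ℝ] ℝ) := fun i => EuclideanSpace.proj i
  let w : E2 → (E2 →L[ℝ] ℝ) := fun x => g₀ x • p 0 + g₁ x • p 1
  have hw : ContDiffOn ℝ (⊤ : ℕ∞) w Ω :=
    (h₀.smul contDiffOn_const).add (h₁.smul contDiffOn_const)
  have key : ∀ a ∈ Ω, ∀ x y, fderiv ℝ w a x y = fderiv ℝ w a y x := by
    intro a ha x y
    have d₀ : HasFDerivAt g₀ (fderiv ℝ g₀ a) a :=
      ((h₀.contDiffAt (hopen.mem_nhds ha)).differentiableAt (by simp)).hasFDerivAt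
    have d₁ : HasFDerivAt g₁ (fderiv ℝ g₁ a) a :=
      ((h₁.contDiffAt (hopen.mem_nhds ha)).differentiableAt (by simp)).hasFDerivAt
    have dw : HasFDerivAt w _ a := (d₀.smul_const (p 0)).add (d₁.smul_const (p 1))
    have hdec : ∀ v : E2, v = v 0 • EuclideanSpace.single (0 : Fin 2) (1 : ℝ)
        + v 1 • EuclideanSpace.single (1 : Fin 2) (1 : ℝ) := by
      intro v; ext i; fin_cases i <;> simp
    have e : ∀ (g : E2 → ℝ) (v : E2), fderiv ℝ g a v = v 0 * pd 0 g a + v 1 * pd 1 g a := by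
      intro g v
      conv_lhs => rw [hdec v]
      simp [pd]
    have := hc a ha
    have hp : ∀ i (v : E2), p i v = v i := fun i v => rfl
    rw [dw.fderiv]
    simp only [add_apply, ContinuousLinearMap.smulRight_apply,
      smul_apply, smul_eq_mul, e, hp, this]
    ring
  obtain ⟨f, hf⟩ := hconv.exists_forall_hasFDerivAt_of_fderiv_symmetric hopen
    (hw.differentiableOn (by simp)) key
  refine ⟨f, ?_, fun x hx => ?_⟩
  · rw [contDiffOn_infty_iff_fderiv_of_isOpen hopen]
    exact ⟨fun x hx => (hf x hx).differentiableAt.differentiableWithinAt,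
      hw.congr fun x hx => (hf x hx).fderiv⟩
  · simp [pd, (hf x hx).fderiv, w, p]

theorem pd_add {Ω : Set E2} (hopen : IsOpen Ω) {f g : E2 → ℝ}
    (hf : ContDiffOn ℝ (⊤ : ℕ∞) f Ω) (hg : ContDiffOn ℝ (⊤ : ℕ∞) g Ω) (i : Fin 2)
    {x : E2} (hx : x ∈ Ω) : pd i (fun y => f y + g y) x = pd i f x + pd i g x := by
  have d₀ := (hf.contDiffAt (hopen.mem_nhds hx)).differentiableAt (by simp)
  have d₁ := (hg.contDiffAt (hopen.mem_nhds hx)).differentiableAt (by simp)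
  simp [pd, fderiv_fun_add d₀ d₁]

theorem pd_neg (f : E2 → ℝ) (i : Fin 2) (x : E2) :
    pd i (fun y => - f y) x = - pd i f x := by
  simp [pd, fderiv_fun_neg]

/-- Qualitative smooth right-inverse of the symcurl operator on a convex open set. -/
theorem statement4 (Ω : Set E2) (hconv : Convex ℝ Ω) (hopen : IsOpen Ω)
    (A : E2 → Matrix (Fin 2) (Fin 2) ℝ)
    (hA : ∀ i j, ContDiffOn ℝ (⊤ : ℕ∞) (fun x => A x i j) Ω)
    (hsymm : ∀ x ∈ Ω, (A x).IsSymm)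
    (hdd : ∀ x ∈ Ω, divDiv A x = 0) :
    ∃ θ : E2 → Fin 2 → ℝ,
      (∀ i, ContDiffOn ℝ (⊤ : ℕ∞) (fun x => θ x i) Ω) ∧
      ∀ x ∈ Ω, symCurl θ x = A x := by
  have hd : ∀ i, ContDiffOn ℝ (⊤ : ℕ∞) (fun x => divMat A x i) Ω := fun i =>
    (pd_contDiffOn hopen (hA i 0) 0).add (pd_contDiffOn hopen (hA i 1) 1)
  -- the skew part
  obtain ⟨q, hq, hqd⟩ := exists_potential hconv hopen (hd 1) (hd 0).neg (by
    intro x hx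
    have := hdd x hx
    rw [pd_neg]
    unfold divDiv at this
    linarith)
  obtain ⟨s, hs, hsd⟩ := exists_potential hconv hopen ((hA 0 1).add hq).neg (hA 0 0) (by
    intro x hx
    rw [pd_neg, pd_add hopen (hA 0 1) hq 1 hx, (hqd x hx).2]
    simp only [divMat]
    ring)
  obtain ⟨t, ht, htd⟩ := exists_potential hconv hopen (hA 1 1).neg ((hA 1 0).add hq.neg) (by
    intro x hx
    rw [pd_neg, pd_add hopen (hA 1 0) hq.neg 0 hx, pd_neg, (hqd x hx).1]
    simp only [divMat]
    ring)
  refine ⟨fun x => ![s x, t x], ?_, ?_⟩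
  · intro i
    fin_cases i
    · simpa using hs
    · simpa using ht
  · intro x hx
    have h10 : A x 1 0 = A x 0 1 := (hsymm x hx).apply 0 1
    obtain ⟨s0, s1⟩ := hsd x hx
    obtain ⟨t0, t1⟩ := htd x hx
    ext i j
    fin_cases i <;> fin_cases j <;>
      simp [symCurl, curlVec, s0, s1, t0, t1, h10] <;> ring


end
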